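/- Let (A,D) be a dependence graph and let (A_j, D_j), j ∈ J, be a finite family of subgraphs of (A,D) with A = ⋃_{j∈J} A_j and D = ⋃_{j∈J} D_j, closed under pairwise intersections: for all j, k ∈ J there exists l ∈ J with A_l = A_j ∩ A_k and D_l = D_j ∩ D_k. Call (w_j)_{j∈J} ∈ ∏_{j∈J} M(A_j,D_j) a compatible family if whenever j, l ∈ J with A_l ⊆ A_j and D_l ⊆ D_j, the canonical projection M(A_j,D_j) → M(A_l,D_l) maps w_j to w_l. A chordless cycle in (A,D) is a tuple (a_1, …, a_n) of n ≥ 3 pairwise distinct elements of A such that D(a_k, a_{k+1}) for all 1 ≤ k < n and D(a_n, a_1), and ¬D(a_k, a_l) for all pairs k ≠ l that are not adjacent in the cyclic order. Then the monoid homomorphism α : M(A,D) → {compatible families}, α(t) = (π_{(A_j,D_j)}(t))_{j∈J}, is bijective if and only if every chordless cycle (a_1, …, a_n) in (A,D) is a cycle in some subgraph (A_j,D_j), i.e., there is j ∈ J with all a_k ∈ A_j and all consecutive pairs (a_k, a_{k+1}) (cyclically) in D_j. -/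

import Mathlib

/-- The pairs generating the trace congruence: `a·b ~ b·a` for independent letters
(`¬ D a b`). -/
def TraceRel (A : Type*) (D : A → A → Prop) :
    FreeMonoid A → FreeMonoid A → Prop := fun x y =>
  ∃ a b : A, ¬ D a b ∧ x = FreeMonoid.of a * FreeMonoid.of b ∧
    y = FreeMonoid.of b * FreeMonoid.of a

/-- The trace congruence on the free monoid over `A` w.r.t. the dependence relation
`D`. -/
def traceCon (A : Type*) (D : A → A → Prop) : Con (FreeMonoid A) :=
  conGen (TraceRel A D)

/-- The trace monoid `M(A,D)`: the quotient of the free monoid on `A` by the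
congruence generated by `a·b = b·a` for all `a, b` with `¬ D a b`. -/
abbrev TraceMonoid (A : Type*) (D : A → A → Prop) := (traceCon A D).Quotient

open Classical in
/-- Word-level projection to the pair of letters `a, b`. -/
noncomputable def ewTr {A B : Type*} (f : B → A) (a b : A) : FreeMonoid B →* FreeMonoid A where
  toFun u := FreeMonoid.ofList ((u.toList.map f).filter (fun x => x = a ∨ x = b))
  map_one' := by simp
  map_mul' u v := by simp

open Classical in
/-- Trace-level projection to the pair of letters `a, b`. -/
noncomputable def phiTr {A B : Type*} (E : B → B → Prop) (f : B → A) (a b : A) :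
    TraceMonoid B E →* FreeMonoid A :=
  if h : traceCon B E ≤ Con.ker (ewTr f a b) then Con.lift _ _ h else 1

/-- The pair `a, b` is dependent. -/
def GoodTr {A B : Type*} (E : B → B → Prop) (f : B → A) (a b : A) : Prop :=
  ∀ x y, f x = a → f y = b → E x y ∧ E y x

lemma ewTr_of {A B : Type*} (f : B → A) (a b : A) (x : B) [Decidable (f x = a ∨ f x = b)] :
    ewTr f a b (FreeMonoid.of x) = if f x = a ∨ f x = b then FreeMonoid.of (f x) else 1 := by
  unfold ewTr
  simp only [MonoidHom.coe_mk, OneHom.coe_mk, FreeMonoid.toList_of, List.map_cons, List.map_nil,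
    List.filter_cons, List.filter_nil, decide_eq_true_eq]
  split_ifs <;> rfl

lemma ewTr_symm {A B : Type*} (f : B → A) (a b : A) : ewTr f a b = ewTr f b a := by
  classical
  apply FreeMonoid.hom_eq
  intro x
  rw [ewTr_of, ewTr_of]
  simp only [or_comm]

lemma good_le {A B : Type*} {E : B → B → Prop} {f : B → A} {a b : A} (h : GoodTr E f a b) :
    traceCon B E ≤ Con.ker (ewTr f a b) := by
  classical
  refine Con.conGen_le.2 ?_
  rintro _ _ ⟨x, y, hxy, rfl, rfl⟩
  rw [Con.ker_rel]
  simp only [map_mul, ewTr_of]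
  have h1 := h x y
  have h2 := h y x
  split_ifs with h3 h4 <;> try simp
  rcases h3 with h3 | h3 <;> rcases h4 with h4 | h4
  · rw [h3, h4]
  · exact absurd (h1 h3 h4).1 hxy
  · exact absurd (h2 h4 h3).2 hxy
  · rw [h3, h4]

lemma phiTr_coe {A B : Type*} {E : B → B → Prop} {f : B → A} {a b : A} (h : GoodTr E f a b)
    (u : FreeMonoid B) : phiTr E f a b (u : TraceMonoid B E) = ewTr f a b u := by
  unfold phiTr
  rw [dif_pos (good_le h)]
  rfl

lemma tr_hom_ext {B M : Type*} [Monoid M] {E : B → B → Prop} {g h : TraceMonoid B E →* M}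
    (H : ∀ x : B, g ((FreeMonoid.of x : FreeMonoid B) : TraceMonoid B E) =
      h ((FreeMonoid.of x : FreeMonoid B) : TraceMonoid B E)) : g = h := by
  have : g.comp (traceCon B E).mk' = h.comp (traceCon B E).mk' := by
    apply FreeMonoid.hom_eq
    exact H
  refine MonoidHom.ext fun x => ?_
  obtain ⟨u, rfl⟩ := Con.mk'_surjective x
  exact DFunLike.congr_fun this u

lemma tr_comm {B : Type*} {E : B → B → Prop} {x y : B} (h : ¬ E x y) :
    ((FreeMonoid.of x * FreeMonoid.of y : FreeMonoid B) : TraceMonoid B E) =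
      ((FreeMonoid.of y * FreeMonoid.of x : FreeMonoid B) : TraceMonoid B E) := by
  rw [Con.eq]
  exact ConGen.Rel.of _ _ ⟨x, y, h, rfl, rfl⟩

lemma of_mul_inj {A : Type*} {x y : A} {u v : FreeMonoid A}
    (h : FreeMonoid.of x * u = FreeMonoid.of y * v) : x = y := by
  have := congrArg FreeMonoid.toList h
  simp at this
  exact this.1

lemma of_mul_ne {A : Type*} {x : A} {u : FreeMonoid A}
    (h : FreeMonoid.of x * u = 1) : False := by
  have := congrArg FreeMonoid.toList h
  simp at this

/-- If `x` comes first in all dependent pairs then it can be moved to the front. -/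
lemma tr_first {A B : Type*} {E : B → B → Prop} {f : B → A} (hf : Function.Injective f)
    (hr : ∀ x, E x x) (x : B) (u : FreeMonoid B)
    (h : ∀ y, E x y → ∃ r, ewTr f (f x) (f y) u = FreeMonoid.of (f x) * r) :
    ∃ v : FreeMonoid B, (u : TraceMonoid B E) = ((FreeMonoid.of x * v : FreeMonoid B)) := by
  classical
  induction u using FreeMonoid.inductionOn' with
  | one =>
    obtain ⟨r, h⟩ := h x (hr x)
    rw [map_one] at h
    exact (of_mul_ne h.symm).elim
  | of_mul z u ih =>
    by_cases hz : z = x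
    · subst hz; exact ⟨u, rfl⟩
    have hzx : f z ≠ f x := fun e => hz (hf e)
    have hE : ¬ E x z := by
      intro hE
      obtain ⟨r, h⟩ := h z hE
      rw [map_mul, ewTr_of, if_pos (Or.inr rfl)] at h
      exact hzx (of_mul_inj h)
    obtain ⟨v, hv⟩ := ih (by
      intro y hy
      obtain ⟨r, h⟩ := h y hy
      have : f z ≠ f y := fun e => hE (by rwa [hf e])
      rw [map_mul, ewTr_of, if_neg (by tauto), one_mul] at h
      exact ⟨r, h⟩)
    refine ⟨FreeMonoid.of z * v, ?_⟩
    rw [Con.coe_mul, hv, ← Con.coe_mul, ← mul_assoc, ← mul_assoc, Con.coe_mul,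
      ← tr_comm hE, ← Con.coe_mul]

lemma tr_good {A B : Type*} {E : B → B → Prop} {f : B → A} (hf : Function.Injective f)
    (hs : ∀ x y, E x y → E y x) {x y : B} (h : E x y) : GoodTr E f (f x) (f y) := by
  intro x' y' hx hy
  rw [hf hx, hf hy]
  exact ⟨h, hs _ _ h⟩

/-- Projection lemma. -/
lemma tr_proj_word {A B : Type*} {E : B → B → Prop} {f : B → A} (hf : Function.Injective f)
    (hr : ∀ x, E x x) (hs : ∀ x y, E x y → E y x) (u v : FreeMonoid B)
    (h : ∀ x y, E x y → ewTr f (f x) (f y) u = ewTr f (f x) (f y) v) :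
    (u : TraceMonoid B E) = (v : TraceMonoid B E) := by
  classical
  induction u using FreeMonoid.inductionOn' generalizing v with
  | one =>
    induction v using FreeMonoid.inductionOn' with
    | one => rfl
    | of_mul z v _ =>
      have := h z z (hr z)
      rw [map_one, map_mul, ewTr_of, if_pos (Or.inr rfl)] at this
      exact (of_mul_ne this.symm).elim
  | of_mul x u ih =>
    obtain ⟨v', hv⟩ := tr_first (E := E) hf hr x v (by
      intro y hy
      rw [← h x y hy, map_mul, ewTr_of, if_pos (Or.inl rfl)]
      exact ⟨_, rfl⟩)
    rw [hv, Con.coe_mul, Con.coe_mul, ih v']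
    intro y z hyz
    have h1 := h y z hyz
    rw [← phiTr_coe (tr_good hf hs hyz) v, hv, phiTr_coe (tr_good hf hs hyz), map_mul,
      map_mul] at h1
    exact mul_left_cancel h1

lemma tr_proj {A B : Type*} {E : B → B → Prop} {f : B → A} (hf : Function.Injective f)
    (hr : ∀ x, E x x) (hs : ∀ x y, E x y → E y x) (u v : TraceMonoid B E)
    (h : ∀ x y, E x y → phiTr E f (f x) (f y) u = phiTr E f (f x) (f y) v) : u = v := by
  obtain ⟨u, rfl⟩ := Con.mk'_surjective u
  obtain ⟨v, rfl⟩ := Con.mk'_surjective v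
  apply tr_proj_word hf hr hs
  intro x y hxy
  have := h x y hxy
  rwa [Con.coe_mk', phiTr_coe (tr_good hf hs hxy), phiTr_coe (tr_good hf hs hxy)] at this

/-- No cyclic precedence inside a single word. -/
lemma tr_nocycle {A B : Type*} (f : B → A) (C : Set A) (hC : C.Nonempty) (u : FreeMonoid B)
    (h : ∀ c ∈ C, ∃ c' ∈ C, c' ≠ c ∧ ∃ r, ewTr f c c' u = FreeMonoid.of c' * r) : False := by
  classical
  induction u using FreeMonoid.inductionOn' with
  | one =>
    obtain ⟨c, hc⟩ := hC
    obtain ⟨c', _, _, r, h⟩ := h c hc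
    rw [map_one] at h
    exact of_mul_ne h.symm
  | of_mul x u ih =>
    by_cases hx : f x ∈ C
    · obtain ⟨c', _, hne, r, h⟩ := h _ hx
      rw [map_mul, ewTr_of, if_pos (Or.inl rfl)] at h
      exact hne (of_mul_inj h).symm
    · apply ih
      intro c hc
      obtain ⟨c', hc', hne, r, h⟩ := h c hc
      refine ⟨c', hc', hne, r, ?_⟩
      rw [map_mul, ewTr_of, if_neg, one_mul] at h
      · exact h
      · rintro (h | h)
        · exact hx (h ▸ hc)
        · exact hx (h ▸ hc')

/-- Chordless cycles exist. -/
lemma exists_chordless {A : Type*} (R : A → A → Prop) (S : Set A) (hfin : S.Finite)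
    (hne : S.Nonempty) (hstep : ∀ a ∈ S, ∃ b ∈ S, R a b) (hirr : ∀ a, ¬ R a a)
    (hanti : ∀ a b, R a b → ¬ R b a) :
    ∃ (n : ℕ) (a : Fin (n + 3) → A), Function.Injective a ∧ (∀ k, a k ∈ S) ∧
      (∀ k, R (a k) (a (k + 1))) ∧ ∀ k l, l ≠ k + 1 → ¬ R (a k) (a l) := by
  classical
  let Q : ℕ → Prop := fun m => 0 < m ∧ ∃ a : ℕ → A, a 0 = a m ∧ (∀ i, a i ∈ S) ∧
    ∀ i < m, R (a i) (a (i + 1))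
  have hQ : ∃ m, Q m := by
    have := hfin.to_subtype
    choose g hg using fun a : S => hstep a a.2
    let G : S → S := fun a => ⟨g a, (hg a).1⟩
    obtain ⟨x, hx⟩ := hne
    have key : ∃ i j, i < j ∧ G^[i] ⟨x, hx⟩ = G^[j] ⟨x, hx⟩ := by
      obtain ⟨i, j, hij, h⟩ := Finite.exists_ne_map_eq_of_infinite (fun i => G^[i] ⟨x, hx⟩)
      rcases lt_or_gt_of_ne hij with h' | h'
      · exact ⟨i, j, h', h⟩
      · exact ⟨j, i, h', h.symm⟩
    obtain ⟨i, j, hij, h⟩ := key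
    refine ⟨j - i, by omega, fun k => (G^[i + k] ⟨x, hx⟩ : S), ?_, fun k => Subtype.coe_prop _, ?_⟩
    · simp only [add_zero]
      rw [h]; congr 3; omega
    · intro k _
      simp only [← add_assoc, Function.iterate_succ_apply']
      exact (hg _).2
  obtain ⟨hpos, a, h0, hS, hR⟩ := Nat.find_spec hQ
  have hmin : ∀ k, k < Nat.find hQ → ¬ Q k := fun k hk => Nat.find_min hQ hk
  generalize Nat.find hQ = m at *
  have hinj : ∀ i j, i < j → j < m → a i ≠ a j := by
    intro i j hij hj e
    refine hmin (j - i) (by omega) ⟨by omega, fun k => a (i + k), ?_, fun k => hS _, ?_⟩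
    · simp only [add_zero]; rw [e]; congr 1; omega
    · intro k hk; exact hR _ (by omega)
  have hback : ∀ i j, i < j → j < m → R (a j) (a i) → i = 0 ∧ j + 1 = m := by
    intro i j hij hj e
    by_contra hcon
    refine hmin (j - i + 1) (by omega) ⟨by omega,
      fun k => if k ≤ j - i then a (i + k) else a i, ?_, fun k => ?_, ?_⟩
    · simp
    · dsimp only; split_ifs <;> exact hS _
    · intro k hk
      by_cases hk' : k = j - i
      · subst hk'
        simp only [le_refl, if_true]
        rw [if_neg (by omega)]
        convert e using 2; omega
      · dsimp only
        rw [if_pos (by omega), if_pos (by omega)]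
        exact hR _ (by omega)
  have hfwd : ∀ i j, i < j → j < m → R (a i) (a j) → j = i + 1 := by
    intro i j hij hj e
    by_contra hcon
    refine hmin (m - (j - i - 1)) (by omega) ⟨by omega,
      fun k => if k ≤ i then a k else a (k + (j - i - 1)), ?_, fun k => ?_, ?_⟩
    · simp only [zero_le, if_true]
      rw [if_neg (by omega), h0]; congr 1; omega
    · dsimp only; split_ifs <;> exact hS _
    · intro k hk
      rcases lt_trichotomy k i with hk' | hk' | hk'
      · dsimp only
        rw [if_pos (by omega), if_pos (by omega)]
        exact hR _ (by omega)
      · subst hk'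
        dsimp only
        rw [if_pos le_rfl, if_neg (by omega)]
        convert e using 2; omega
      · dsimp only
        rw [if_neg (by omega), if_neg (by omega)]
        convert hR (k + (j - i - 1)) (by omega) using 2; omega
  have hm3 : 3 ≤ m := by
    by_contra hlt
    have : m = 1 ∨ m = 2 := by omega
    rcases this with rfl | rfl
    · have := hR 0 (by omega)
      rw [zero_add, ← h0] at this
      exact hirr _ this
    · have h1 := hR 0 (by omega)
      have h2 := hR 1 (by omega)
      rw [show 1 + 1 = 2 from rfl, ← h0] at h2
      exact hanti _ _ h1 h2
  obtain ⟨n, rfl⟩ : ∃ n, m = n + 3 := ⟨m - 3, by omega⟩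
  have hval : ∀ k : Fin (n + 3), ((k + 1 : Fin (n + 3)) : ℕ) =
      if (k : ℕ) = n + 2 then 0 else (k : ℕ) + 1 := by
    intro k
    rw [Fin.val_add_one]
    simp [Fin.ext_iff]
  refine ⟨n, fun k => a k, ?_, fun k => hS _, ?_, ?_⟩
  · intro k l e
    by_contra hkl
    have : (k : ℕ) ≠ l := fun h => hkl (Fin.ext h)
    rcases lt_or_gt_of_ne this with h | h
    · exact hinj _ _ h l.2 e
    · exact hinj _ _ h k.2 e.symm
  · intro k
    have := hR k k.2
    dsimp only
    rw [hval]
    split_ifs with h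
    · rw [h0]; rwa [h] at this ⊢
    · exact this
  · intro k l hkl e
    apply hkl
    apply Fin.ext
    rw [hval]
    rcases lt_trichotomy (k : ℕ) l with h | h | h
    · have := hfwd _ _ h l.2 e
      have := l.2
      rw [if_neg (by omega)]; omega
    · simp only [h] at e
      exact (hirr _ e).elim
    · have := hback _ _ h k.2 e
      rw [if_pos (by omega)]; omega

/-- Length of a trace. -/
def lenTr {B : Type*} (E : B → B → Prop) : TraceMonoid B E →* Multiplicative ℕ :=
  Con.lift _ (FreeMonoid.lift (fun _ => Multiplicative.ofAdd 1)) (by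
    refine Con.conGen_le.2 ?_
    rintro _ _ ⟨x, y, hxy, rfl, rfl⟩
    rw [Con.ker_rel]
    simp)

lemma lenTr_of {B : Type*} (E : B → B → Prop) (x : B) :
    lenTr E ((FreeMonoid.of x : FreeMonoid B) : TraceMonoid B E) = Multiplicative.ofAdd 1 := rfl

lemma phiTr_symm {A B : Type*} {E : B → B → Prop} (f : B → A) (a b : A) :
    phiTr E f a b = phiTr E f b a := by
  unfold phiTr
  rw [ewTr_symm]

lemma ewTr_eq_one {A B : Type*} (f : B → A) (a b : A) (u : FreeMonoid B) :
    ewTr f a b u = 1 ↔ ∀ x ∈ u.toList, f x ≠ a ∧ f x ≠ b := by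
  have : ewTr f a b u = 1 ↔ (ewTr f a b u).toList = [] := by
    rw [← FreeMonoid.toList_one, FreeMonoid.toList.injective.eq_iff]
  rw [this]
  simp [ewTr]

lemma ewTr_ne_left {A B : Type*} {f : B → A} {a : A} (b : A) {u : FreeMonoid B}
    (h : ewTr f a a u ≠ 1) : ewTr f a b u ≠ 1 := by
  intro h'
  apply h
  rw [ewTr_eq_one] at *
  intro x hx
  exact ⟨(h' x hx).1, (h' x hx).1⟩

lemma ewTr_head {A B : Type*} {f : B → A} {a b : A} {u : FreeMonoid B}
    (h : ewTr f a b u ≠ 1) : (∃ r, ewTr f a b u = FreeMonoid.of a * r) ∨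
      ∃ r, ewTr f a b u = FreeMonoid.of b * r := by
  classical
  induction u using FreeMonoid.inductionOn' with
  | one => simp at h
  | of_mul x u ih =>
    rw [map_mul, ewTr_of] at h ⊢
    split_ifs at h ⊢ with hx
    · rcases hx with hx | hx
      · left; exact ⟨_, by rw [hx]⟩
      · right; exact ⟨_, by rw [hx]⟩
    · rw [one_mul] at h ⊢
      exact ih h

lemma ewTr_ne_of_head {A B : Type*} {f : B → A} {a b : A} {u r : FreeMonoid _}
    (h : ewTr f a b u = FreeMonoid.of b * r) : ewTr f b b u ≠ 1 := by
  intro h'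
  rw [ewTr_eq_one] at h'
  have : b ∈ (ewTr f a b u).toList := by rw [h]; simp
  simp only [ewTr, MonoidHom.coe_mk, OneHom.coe_mk, FreeMonoid.toList_ofList, List.mem_filter,
    List.mem_map] at this
  obtain ⟨⟨x, hx, e⟩, _⟩ := this
  exact (h' x hx).1 e

lemma ewTr_finite {A B : Type*} (f : B → A) (u : FreeMonoid B) :
    {a | ewTr f a a u ≠ 1}.Finite := by
  refine (List.finite_toSet (u.toList.map f)).subset ?_
  intro a ha
  by_contra hcon
  apply ha
  rw [ewTr_eq_one]
  intro x hx
  have : f x ≠ a := by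
    rintro rfl
    exact hcon (List.mem_map_of_mem hx)
  exact ⟨this, this⟩

/-- The cyclic word starting at `s`. -/
def cycW {A : Type*} {n : ℕ} (a : Fin (n + 3) → A) (s : Fin (n + 3)) : List A :=
  (List.finRange (n + 3)).map (fun i => a (i + s))

lemma cycW_perm {A : Type*} {n : ℕ} {a : Fin (n + 3) → A} (ha : Function.Injective a)
    (s t : Fin (n + 3)) : (cycW a s).Perm (cycW a t) := by
  have hn : ∀ s, (cycW a s).Nodup := fun s =>
    (List.nodup_finRange _).map (fun x y h => add_right_cancel (ha h))
  have hm : ∀ s x, x ∈ cycW a s ↔ ∃ m, a m = x := by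
    intro s x
    simp only [cycW, List.mem_map, List.mem_finRange, true_and]
    constructor
    · rintro ⟨i, rfl⟩; exact ⟨_, rfl⟩
    · rintro ⟨i, rfl⟩; exact ⟨i - s, by simp⟩
  rw [List.perm_ext_iff_of_nodup (hn s) (hn t)]
  intro x
  rw [hm, hm]

open Classical in
lemma cycW_pairwise {A : Type*} {D E : A → A → Prop} {n : ℕ} {a : Fin (n + 3) → A}
    (ha : Function.Injective a)
    (hch : ∀ k l : Fin (n + 3), k ≠ l → l ≠ k + 1 → k ≠ l + 1 → ¬ D (a k) (a l))
    (hED : ∀ x y, E x y → D x y) (hs : ∀ x y, E x y → E y x)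
    {k : Fin (n + 3)} (hk : ¬ E (a k) (a (k + 1))) {c d : A} (hcd : E c d) :
    ((cycW a (k + 1)).filter (fun x => x = c ∨ x = d)).Pairwise
      (fun x y => ∃ m, x = a m ∧ y = a (m + 1)) := by
  rw [List.pairwise_filter, cycW, List.pairwise_map]
  refine (List.pairwise_lt_finRange _).imp ?_
  intro i i' hii' h1 h2
  simp only [decide_eq_true_eq] at h1 h2
  have hne : i + (k + 1) ≠ i' + (k + 1) := fun h => hii'.ne (add_right_cancel h)
  have hE : E (a (i + (k + 1))) (a (i' + (k + 1))) := by
    rcases h1 with h1 | h1 <;> rcases h2 with h2 | h2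
    · exact absurd (ha (h1.trans h2.symm)) hne
    · rwa [h1, h2]
    · rw [h1, h2]; exact hs _ _ hcd
    · exact absurd (ha (h1.trans h2.symm)) hne
  by_cases e1 : i' + (k + 1) = i + (k + 1) + 1
  · exact ⟨_, rfl, by rw [e1]⟩
  by_cases e2 : i + (k + 1) = i' + (k + 1) + 1
  · exfalso
    have h3 : i = i' + 1 := by
      apply add_right_cancel (b := k + 1)
      rw [e2]; abel
    have h4 : i' = Fin.last _ := by
      by_contra hne'
      have := Fin.val_add_one i'
      rw [if_neg hne', ← h3] at this
      have := Fin.lt_def.1 hii'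
      omega
    have h5 : i' + 1 = 0 := by rw [h4]; simp
    apply hk
    have h6 : i' + (k + 1) = k := by
      rw [add_comm k 1, ← add_assoc, h5, zero_add]
    rw [e2, h6] at hE
    exact hs _ _ hE
  · exact absurd (hED _ _ hE) (hch _ _ hne e1 e2)

lemma fin_two_ne {n : ℕ} {m i : Fin (n + 3)} (h1 : m + 1 = i) (h2 : m = i + 1) : False := by
  subst h1
  have : (m : Fin (n + 3)) + (1 + 1) = m + 0 := by rw [← add_assoc, ← h2, add_zero]
  have := add_left_cancel this
  have := congrArg Fin.val this
  simp [Fin.val_add, Nat.mod_eq_of_lt] at this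

/-- Let `(A,D)` be a dependence graph and `(A' j, D' j)`, `j ∈ J`, a
finite family of subgraphs covering `(A,D)` and closed under pairwise intersections.
Let `π j : M(A,D) → M(A' j, D' j)` be the canonical projections, and for
`(A' l, D' l) ⊆ (A' j, D' j)` let `ρ j l` be the canonical projection
`M(A' j, D' j) → M(A' l, D' l)`. A family `(w j)ⱼ` is *compatible* if `ρ j l` maps
`w j` to `w l` whenever `(A' l, D' l) ⊆ (A' j, D' j)`. Then
`α : t ↦ (π j t)ⱼ` is a bijection from `M(A,D)` onto the set of compatible families iff
every chordless cycle of `(A,D)` (a tuple of `n ≥ 3` pairwise distinct vertices,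
cyclically consecutive ones dependent, all other pairs independent) is a cycle in some
subgraph `(A' j, D' j)`. -/
theorem stmt13 {A : Type*} (D : A → A → Prop)
    (hD_refl : ∀ a, D a a) (hD_symm : ∀ a b, D a b → D b a)
    {J : Type*} [Finite J]
    (A' : J → Set A) (D' : J → A → A → Prop)
    (hsub : ∀ j a b, D' j a b → D a b)
    (hsupp : ∀ j a b, D' j a b → a ∈ A' j ∧ b ∈ A' j)
    (hrefl' : ∀ j, ∀ a ∈ A' j, D' j a a)
    (hsymm' : ∀ j a b, D' j a b → D' j b a)
    (hcoverA : ∀ a : A, ∃ j, a ∈ A' j)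
    (hcoverD : ∀ a b : A, D a b ↔ ∃ j, D' j a b)
    (hinter : ∀ j k : J, ∃ l : J, A' l = A' j ∩ A' k ∧
      ∀ a b : A, D' l a b ↔ (D' j a b ∧ D' k a b))
    (π : ∀ j, TraceMonoid A D →* TraceMonoid (A' j) (fun x y => D' j x y))
    (hπ_mem : ∀ j (a : A) (h : a ∈ A' j),
      π j ((FreeMonoid.of a : FreeMonoid A) : TraceMonoid A D) =
        ((FreeMonoid.of (⟨a, h⟩ : A' j) : FreeMonoid (A' j)) :
          TraceMonoid (A' j) (fun x y => D' j x y)))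
    (hπ_not : ∀ j (a : A), a ∉ A' j →
      π j ((FreeMonoid.of a : FreeMonoid A) : TraceMonoid A D) = 1)
    (ρ : ∀ j l, A' l ⊆ A' j → (∀ a b : A, D' l a b → D' j a b) →
      TraceMonoid (A' j) (fun x y => D' j x y) →*
        TraceMonoid (A' l) (fun x y => D' l x y))
    (hρ_mem : ∀ j l (hA : A' l ⊆ A' j) (hD : ∀ a b : A, D' l a b → D' j a b)
        (a : A) (ha : a ∈ A' j) (hal : a ∈ A' l),
      ρ j l hA hD ((FreeMonoid.of (⟨a, ha⟩ : A' j) : FreeMonoid (A' j)) :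
          TraceMonoid (A' j) (fun x y => D' j x y)) =
        ((FreeMonoid.of (⟨a, hal⟩ : A' l) : FreeMonoid (A' l)) :
          TraceMonoid (A' l) (fun x y => D' l x y)))
    (hρ_not : ∀ j l (hA : A' l ⊆ A' j) (hD : ∀ a b : A, D' l a b → D' j a b)
        (a : A) (ha : a ∈ A' j), a ∉ A' l →
      ρ j l hA hD ((FreeMonoid.of (⟨a, ha⟩ : A' j) : FreeMonoid (A' j)) :
          TraceMonoid (A' j) (fun x y => D' j x y)) = 1) :
    (Function.Injective (fun (t : TraceMonoid A D) (j : J) => π j t) ∧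
      Set.range (fun (t : TraceMonoid A D) (j : J) => π j t) =
        {w : ∀ j, TraceMonoid (A' j) (fun x y => D' j x y) |
          ∀ j l (hA : A' l ⊆ A' j) (hD : ∀ a b : A, D' l a b → D' j a b),
            ρ j l hA hD (w j) = w l}) ↔
    (∀ (n : ℕ) (a : Fin (n + 3) → A), Function.Injective a →
      (∀ k : Fin (n + 3), D (a k) (a (k + 1))) →
      (∀ k l : Fin (n + 3), k ≠ l → l ≠ k + 1 → k ≠ l + 1 → ¬ D (a k) (a l)) →
      ∃ j, (∀ k, a k ∈ A' j) ∧ ∀ k : Fin (n + 3), D' j (a k) (a (k + 1))) := by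
  classical
  have hgood : ∀ j a b, D' j a b →
      GoodTr (fun x y : A' j => D' j x y) Subtype.val a b := by
    rintro j a b h x y rfl rfl
    exact ⟨h, hsymm' _ _ _ h⟩
  have hgoodA : ∀ a b, D a b → GoodTr D id a b := by
    rintro a b h x y rfl rfl
    exact ⟨h, hD_symm _ _ h⟩
  have hφπ : ∀ j a b, D' j a b → ∀ t,
      phiTr (fun x y : A' j => D' j x y) Subtype.val a b (π j t) = phiTr D id a b t := by
    intro j a b h t
    have : (phiTr (fun x y : A' j => D' j x y) Subtype.val a b).comp (π j) =
        phiTr D id a b := by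
      apply tr_hom_ext
      intro x
      rw [MonoidHom.comp_apply, phiTr_coe (hgoodA _ _ (hsub _ _ _ h)), ewTr_of]
      by_cases hx : x ∈ A' j
      · rw [hπ_mem j x hx, phiTr_coe (hgood _ _ _ h), ewTr_of]
        rfl
      · rw [hπ_not j x hx, map_one, if_neg]
        rintro (rfl | rfl)
        · exact hx (hsupp _ _ _ h).1
        · exact hx (hsupp _ _ _ h).2
    exact DFunLike.congr_fun this t
  have hφρ : ∀ j l (hA : A' l ⊆ A' j) (hD : ∀ a b : A, D' l a b → D' j a b) a b, D' l a b →
      ∀ t, phiTr (fun x y : A' l => D' l x y) Subtype.val a b (ρ j l hA hD t) =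
        phiTr (fun x y : A' j => D' j x y) Subtype.val a b t := by
    intro j l hA hD a b h t
    have : (phiTr (fun x y : A' l => D' l x y) Subtype.val a b).comp (ρ j l hA hD) =
        phiTr (fun x y : A' j => D' j x y) Subtype.val a b := by
      apply tr_hom_ext
      rintro ⟨x, hxj⟩
      rw [MonoidHom.comp_apply, phiTr_coe (hgood _ _ _ (hD _ _ h)), ewTr_of]
      by_cases hx : x ∈ A' l
      · rw [hρ_mem j l hA hD x hxj hx, phiTr_coe (hgood _ _ _ h), ewTr_of]
      · rw [hρ_not j l hA hD x hxj hx, map_one, if_neg]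
        rintro (rfl | rfl)
        · exact hx (hsupp _ _ _ h).1
        · exact hx (hsupp _ _ _ h).2
    exact DFunLike.congr_fun this t
  have hρπ : ∀ j l (hA : A' l ⊆ A' j) (hD : ∀ a b : A, D' l a b → D' j a b) t,
      ρ j l hA hD (π j t) = π l t := by
    intro j l hA hD t
    have : (ρ j l hA hD).comp (π j) = π l := by
      apply tr_hom_ext
      intro x
      rw [MonoidHom.comp_apply]
      by_cases hx : x ∈ A' j
      · rw [hπ_mem j x hx]
        by_cases hxl : x ∈ A' l
        · rw [hρ_mem j l hA hD x hx hxl, hπ_mem l x hxl]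
        · rw [hρ_not j l hA hD x hx hxl, hπ_not l x hxl]
      · rw [hπ_not j x hx, map_one, hπ_not l x (fun h => hx (hA h))]
    exact DFunLike.congr_fun this t
  have hproj : ∀ j (u v : TraceMonoid (A' j) (fun x y => D' j x y)),
      (∀ a b, D' j a b → phiTr (fun x y : A' j => D' j x y) Subtype.val a b u =
        phiTr (fun x y : A' j => D' j x y) Subtype.val a b v) → u = v := by
    intro j u v h
    refine tr_proj (f := (Subtype.val : A' j → A)) Subtype.val_injective
      (fun x => hrefl' j x x.2) (fun x y => hsymm' j x y) u v ?_
    intro x y hxy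
    exact h _ _ hxy
  have hcancel : ∀ j (z u v : TraceMonoid (A' j) (fun x y => D' j x y)),
      z * u = z * v → u = v := by
    intro j z u v h
    apply hproj
    intro a b _
    have := congrArg (phiTr (fun x y : A' j => D' j x y) Subtype.val a b) h
    rw [map_mul, map_mul] at this
    exact mul_left_cancel this
  have hinj : Function.Injective (fun (t : TraceMonoid A D) (j : J) => π j t) := by
    intro t s h
    refine tr_proj (f := (id : A → A)) Function.injective_id hD_refl hD_symm t s ?_
    intro x y hxy
    obtain ⟨j, hj⟩ := (hcoverD x y).1 hxy
    rw [id, id, ← hφπ j x y hj, ← hφπ j x y hj]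
    exact congrArg _ (congrFun h j)
  constructor
  · rintro ⟨-, hrange⟩ n a ha hcyc hch
    by_contra hcon
    have hk : ∀ j, ∃ k : Fin (n + 3), ¬ D' j (a k) (a (k + 1)) := by
      intro j
      by_contra h
      push Not at h
      exact hcon ⟨j, fun k => (hsupp _ _ _ (h k)).1, h⟩
    choose k hk using hk
    have hpw := fun j c d (hcd : D' j c d) =>
      cycW_pairwise (D := D) (E := D' j) ha hch (hsub j) (hsymm' j) (hk j) hcd
    have hX : ∀ c d, D c d → ∀ s, phiTr D id c d
        ((FreeMonoid.ofList (cycW a s) : FreeMonoid A) : TraceMonoid A D) =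
        FreeMonoid.ofList ((cycW a s).filter (fun x => x = c ∨ x = d)) := by
      intro c d hcd s
      rw [phiTr_coe (hgoodA c d hcd)]
      simp [ewTr]
    let w : ∀ j, TraceMonoid (A' j) (fun x y => D' j x y) := fun j =>
      π j ((FreeMonoid.ofList (cycW a (k j + 1)) : FreeMonoid A) : TraceMonoid A D)
    have hw : w ∈ Set.range (fun (t : TraceMonoid A D) (j : J) => π j t) := by
      rw [hrange]
      intro j l hA hD
      simp only [w]
      rw [hρπ]
      apply hproj
      intro c d hcd
      rw [hφπ _ _ _ hcd, hφπ _ _ _ hcd, hX _ _ (hsub _ _ _ hcd), hX _ _ (hsub _ _ _ hcd)]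
      congr 1
      refine List.Perm.eq_of_pairwise ?_ (hpw j c d (hD _ _ hcd)) (hpw l c d hcd)
        ((cycW_perm ha _ _).filter _)
      rintro x y - - ⟨m, rfl, rfl⟩ ⟨i, h1, h2⟩
      exact (fin_two_ne (ha h1) (ha h2)).elim
    obtain ⟨t, ht⟩ := hw
    obtain ⟨u, rfl⟩ := Con.mk'_surjective t
    refine tr_nocycle (id : A → A) (Set.range a) ⟨a 0, 0, rfl⟩ u ?_
    rintro _ ⟨m', rfl⟩
    obtain ⟨m, rfl⟩ : ∃ m, m' = m + 1 := ⟨m' - 1, by simp⟩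
    refine ⟨a m, ⟨m, rfl⟩, ?_, ?_⟩
    · intro h
      have := ha h
      simp at this
    obtain ⟨j, hj⟩ := (hcoverD _ _).1 (hcyc m)
    have h1 := hφπ j _ _ hj (((traceCon A D).mk') u)
    have h2 : π j (((traceCon A D).mk') u) = w j := congrFun ht j
    rw [h2, Con.coe_mk', phiTr_coe (hgoodA _ _ (hcyc m))] at h1
    simp only [w] at h1
    rw [hφπ j _ _ hj, hX _ _ (hcyc m)] at h1
    rw [ewTr_symm, ← h1]
    have h3 := hpw j _ _ hj
    have hmem : ∀ i s, a i ∈ cycW a s := by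
      intro i s
      simp only [cycW, List.mem_map, List.mem_finRange, true_and]
      exact ⟨i - s, by simp⟩
    have h4 : a m ∈ (cycW a (k j + 1)).filter (fun x => x = a m ∨ x = a (m + 1)) := by
      simp [hmem]
    have h5 : ∀ x ∈ (cycW a (k j + 1)).filter (fun x => x = a m ∨ x = a (m + 1)),
        x = a m ∨ x = a (m + 1) := by
      intro x hx
      simpa using (List.mem_filter.1 hx).2
    generalize (cycW a (k j + 1)).filter (fun x => x = a m ∨ x = a (m + 1)) = X at h3 h4 h5
    cases X with
    | nil => simp at h4
    | cons x X =>
      have : x = a m := by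
        rcases h5 x (by simp) with h | h
        · exact h
        · rcases List.mem_cons.1 h4 with h' | h'
          · exact h'.symm
          · obtain ⟨i, h6, h7⟩ := (List.pairwise_cons.1 h3).1 _ h'
            rw [h] at h6
            exact (fin_two_ne (ha h6) (ha h7)).elim
      subst this
      exact ⟨FreeMonoid.ofList X, rfl⟩
  · intro hcyc
    refine ⟨hinj, Set.Subset.antisymm ?_ ?_⟩
    · rintro _ ⟨t, rfl⟩ j l hA hD
      exact hρπ j l hA hD t
    have : Fintype J := Fintype.ofFinite J
    have surj : ∀ (N : ℕ) (w : ∀ j, TraceMonoid (A' j) (fun x y => D' j x y)),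
        (∀ j l (hA : A' l ⊆ A' j) (hD : ∀ a b : A, D' l a b → D' j a b),
            ρ j l hA hD (w j) = w l) →
        ∑ j, (lenTr _ (w j)).toAdd = N → ∃ t, ∀ j, π j t = w j := by
      intro N
      induction N using Nat.strong_induction_on with
      | _ N ih =>
      intro w hw hN
      have hindep : ∀ j k a b, D' j a b → D' k a b →
          phiTr (fun x y : A' j => D' j x y) Subtype.val a b (w j) =
          phiTr (fun x y : A' k => D' k x y) Subtype.val a b (w k) := by
        intro j k a b hj hk
        obtain ⟨l, hlA, hlD⟩ := hinter j k
        have hl : D' l a b := (hlD a b).2 ⟨hj, hk⟩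
        rw [← hφρ j l (by rw [hlA]; exact Set.inter_subset_left)
            (fun a b h => ((hlD a b).1 h).1) a b hl,
          ← hφρ k l (by rw [hlA]; exact Set.inter_subset_right)
            (fun a b h => ((hlD a b).1 h).2) a b hl, hw, hw]
      obtain ⟨e, he⟩ : ∃ e : A → A → FreeMonoid A, ∀ j a b, D' j a b →
          phiTr (fun x y : A' j => D' j x y) Subtype.val a b (w j) = e a b := by
        refine ⟨fun a b => if h : ∃ j, D' j a b then
          phiTr (fun x y : A' h.choose => D' h.choose x y) Subtype.val a b (w h.choose) else 1, ?_⟩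
        intro j a b h
        have h' : ∃ j, D' j a b := ⟨j, h⟩
        simp only [dif_pos h']
        exact hindep _ _ _ _ h h'.choose_spec
      choose u hu using fun j => Con.mk'_surjective (w j)
      have heu : ∀ j a b, D' j a b → ewTr (Subtype.val : A' j → A) a b (u j) = e a b := by
        intro j a b h
        rw [← he j a b h, ← hu j, Con.coe_mk', phiTr_coe (hgood j a b h)]
      by_cases hmin : ∃ a, ∀ b, D a b → ∃ r, e a b = FreeMonoid.of a * r
      · obtain ⟨a, hmin⟩ := hmin
        let α : TraceMonoid A D := ((FreeMonoid.of a : FreeMonoid A) : TraceMonoid A D)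
        have hstrip : ∀ j, ∃ v, w j = π j α * v := by
          intro j
          by_cases haj : a ∈ A' j
          · obtain ⟨v, hv⟩ := tr_first (E := fun x y : A' j => D' j x y)
              (f := (Subtype.val : A' j → A)) Subtype.val_injective
              (fun x => hrefl' j x x.2) ⟨a, haj⟩ (u j) (by
                intro y hy
                rw [heu j _ _ hy]
                exact hmin _ (hsub _ _ _ hy))
            refine ⟨(v : FreeMonoid (A' j)), ?_⟩
            rw [hπ_mem j a haj, ← Con.coe_mul, ← hv, ← hu j]
            rfl
          · exact ⟨w j, by rw [hπ_not j a haj, one_mul]⟩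
        choose w' hw' using hstrip
        have hlen : ∀ j, (lenTr _ (w j)).toAdd =
            (lenTr _ (π j α)).toAdd + (lenTr _ (w' j)).toAdd := by
          intro j
          rw [hw' j, map_mul, toAdd_mul]
        obtain ⟨t, ht⟩ := ih (∑ j, (lenTr _ (w' j)).toAdd) (by
            rw [← hN]
            obtain ⟨j, hj⟩ := hcoverA a
            refine Finset.sum_lt_sum (fun j _ => by rw [hlen j]; omega)
              ⟨j, Finset.mem_univ _, ?_⟩
            rw [hlen j, hπ_mem j a hj, lenTr_of]
            simp) w' (by
            intro j l hA hD
            apply hcancel l (π l α)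
            rw [← hw' l, ← hw j l hA hD, hw' j, map_mul, hρπ]) rfl
        refine ⟨α * t, fun j => ?_⟩
        rw [map_mul, ht, ← hw' j]
      · push Not at hmin
        by_cases hS : ∃ a, e a a ≠ 1
        swap
        · push Not at hS
          refine ⟨1, fun j => ?_⟩
          rw [map_one]
          symm
          apply hproj
          intro a b hab
          rw [he j a b hab, map_one, ← heu j a b hab, ewTr_eq_one]
          intro x hx
          have h1 := hS x
          rw [← heu j _ _ (hrefl' j x x.2), ewTr_eq_one] at h1
          exact absurd rfl (h1 x hx).1
        exfalso
        have hsymm : ∀ a b, D a b → e a b = e b a := by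
          intro a b h
          obtain ⟨j, hj⟩ := (hcoverD a b).1 h
          rw [← he j a b hj, ← he j b a (hsymm' _ _ _ hj), phiTr_symm]
        have hhead : ∀ a b, D a b → e a a ≠ 1 → (∃ r, e a b = FreeMonoid.of a * r) ∨
            ∃ r, e a b = FreeMonoid.of b * r := by
          intro a b h ha
          obtain ⟨j, hj⟩ := (hcoverD a b).1 h
          rw [← heu j _ _ (hrefl' j a (hsupp _ _ _ hj).1)] at ha
          rw [← heu j a b hj]
          exact ewTr_head (ewTr_ne_left b ha)
        have hfin : {a | e a a ≠ 1}.Finite := by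
          refine (Set.finite_iUnion (fun j => ewTr_finite (Subtype.val : A' j → A) (u j))).subset ?_
          intro a ha
          obtain ⟨j, hj⟩ := hcoverA a
          refine Set.mem_iUnion.2 ⟨j, ?_⟩
          rw [Set.mem_setOf_eq, heu j a a (hrefl' j a hj)]
          exact ha
        obtain ⟨n, a, hainj, haS, haR, hanR⟩ := exists_chordless
          (fun a b => a ≠ b ∧ D a b ∧ ∃ r, e a b = FreeMonoid.of b * r) {a | e a a ≠ 1} hfin hS
          (by
            intro a ha
            obtain ⟨b, hab, hb⟩ := hmin a
            have h1 : ∃ r, e a b = FreeMonoid.of b * r := by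
              rcases hhead a b hab ha with ⟨r, h⟩ | h
              · exact absurd h (hb r)
              · exact h
            refine ⟨b, ?_, ?_, hab, h1⟩
            · obtain ⟨j, hj⟩ := (hcoverD a b).1 hab
              obtain ⟨r, hr⟩ := h1
              rw [← heu j a b hj] at hr
              rw [Set.mem_setOf_eq, ← heu j b b (hrefl' j b (hsupp _ _ _ hj).2)]
              exact ewTr_ne_of_head hr
            · rintro rfl
              obtain ⟨r, hr⟩ := h1
              exact hb r hr)
          (fun a h => h.1 rfl)
          (by
            rintro a b ⟨hne, hab, r, hr⟩ ⟨-, -, s, hs⟩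
            rw [hsymm a b hab, hs] at hr
            exact hne (of_mul_inj hr))
        obtain ⟨j, -, hj⟩ := hcyc n a hainj (fun k => (haR k).2.1) (by
          intro k l hkl h1 h2 hd
          have hne : a k ≠ a l := fun h => hkl (hainj h)
          rcases hhead _ _ hd (haS k) with ⟨r, hr⟩ | hr
          · refine hanR l k h2 ⟨hne.symm, hD_symm _ _ hd, r, ?_⟩
            rw [← hsymm _ _ hd, hr]
          · exact hanR k l h1 ⟨hne, hd, hr⟩)
        refine tr_nocycle (Subtype.val : A' j → A) (Set.range a) ⟨a 0, 0, rfl⟩ (u j) ?_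
        rintro _ ⟨k, rfl⟩
        refine ⟨a (k + 1), ⟨_, rfl⟩, (haR k).1.symm, ?_⟩
        rw [heu j _ _ (hj k)]
        exact (haR k).2.2
    intro w hw
    obtain ⟨t, ht⟩ := surj _ w hw rfl
    exact ⟨t, funext ht⟩
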